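/- Suppose G is a profinite group that is a Cartesian (direct) product of non-abelian finite simple groups, and suppose that for some positive integer n the word [x, ₙy] takes strictly fewer than 2^ℵ₀ values in G. Then G is finite. -/

import Mathlib

/-- The commutator `[a,b] = a⁻¹b⁻¹ab`. -/
def cmt {G : Type*} [Group G] (a b : G) : G := a⁻¹ * b⁻¹ * a * b

/-- The left-normed iterated commutator `[x, ₙg]` with `n` copies of `g`. -/
def engel {G : Type*} [Group G] (x g : G) : ℕ → G
  | 0 => x
  | n + 1 => cmt (engel x g n) g

theorem map_engel {G H : Type*} [Group G] [Group H] (f : G →* H) (x y : G) (n : ℕ) :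
    f (engel x y n) = engel (f x) (f y) n := by
  induction n with
  | zero => rfl
  | succ k ih => simp [engel, cmt, ih]

theorem one_engel {G : Type*} [Group G] (y : G) (n : ℕ) : engel 1 y n = 1 := by
  induction n with
  | zero => rfl
  | succ k ih => simp [engel, cmt, ih]

namespace Subgroup

variable {G : Type*} [Group G]

theorem exists_mem_normalizer_notMem_of_lt {H K : Subgroup G} [Group.IsNilpotent K] (h : H < K) :
    ∃ x ∈ K, x ∈ normalizer (H : Set G) ∧ x ∉ H := by
  have hlt := Group.normalizerCondition_of_isNilpotent (G := K) (H.subgroupOf K)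
    (lt_top_iff_ne_top.2 fun e => h.not_ge (subgroupOf_eq_top.1 e))
  rw [← subgroupOf_normalizer_eq h.le] at hlt
  obtain ⟨x, hx, hxH⟩ := SetLike.exists_of_lt hlt
  exact ⟨x, x.2, hx, hxH⟩

theorem Normal.of_isCoatom_of_isNilpotent_quotient {M D : Subgroup G} [D.Normal]
    [Group.IsNilpotent (G ⧸ D)] (hM : IsCoatom M) (hDM : D ≤ M) : M.Normal := by
  have hsurj : Function.Surjective (QuotientGroup.mk' D) := QuotientGroup.mk'_surjective D
  have hcomap : (M.map (QuotientGroup.mk' D)).comap (QuotientGroup.mk' D) = M :=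
    comap_map_eq_self (by simpa using hDM)
  have hcoatom : IsCoatom (M.map (QuotientGroup.mk' D)) := by
    refine ⟨fun h => hM.1 ?_, fun K hK => ?_⟩
    · rw [← hcomap, h, comap_top]
    · rw [← (comap_lt_comap_of_surjective hsurj), hcomap] at hK
      rw [← map_comap_eq_self_of_surjective hsurj K, hM.2 _ hK, map_top_of_surjective _ hsurj]
  rw [← hcomap]
  exact (NormalizerCondition.normal_of_coatom _
    Group.normalizerCondition_of_isNilpotent hcoatom).comap _

/-- If all proper subgroups and all proper quotients of a finite group are nilpotent, then a
non-normal maximal subgroup meets every other maximal subgroup trivially. -/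
theorem inf_eq_bot_of_isCoatom_of_not_normal [Finite G]
    (hsub : ∀ H : Subgroup G, H ≠ ⊤ → Group.IsNilpotent H)
    (hquot : ∀ (N : Subgroup G) [N.Normal], N ≠ ⊥ → Group.IsNilpotent (G ⧸ N))
    {M K : Subgroup G} (hM : IsCoatom M) (hMn : ¬ M.Normal) (hK : IsCoatom K) (hne : M ≠ K) :
    M ⊓ K = ⊥ := by
  let A : Set (Subgroup G) :=
    {D | ∃ M K : Subgroup G, IsCoatom M ∧ ¬ M.Normal ∧ IsCoatom K ∧ M ≠ K ∧ D = M ⊓ K}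
  have hmem : M ⊓ K ∈ A := ⟨M, K, hM, hMn, hK, hne, rfl⟩
  obtain ⟨D, hle, hD⟩ := A.toFinite.exists_le_maximal hmem
  suffices D = ⊥ from le_bot_iff.1 (this ▸ hle)
  clear hle hmem hne hK hMn hM
  obtain ⟨⟨M, K, hM, hMn, hK, hne, rfl⟩, hmax⟩ := hD
  have hMlt : M ⊓ K < M :=
    inf_le_left.lt_of_ne fun e => hne ((hM.le_iff_eq hK.1).1 (inf_eq_left.1 e)).symm
  have hKlt : M ⊓ K < K :=
    inf_le_right.lt_of_ne fun e => hne ((hK.le_iff_eq hM.1).1 (inf_eq_right.1 e))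
  have := hsub M hM.1
  have := hsub K hK.1
  obtain ⟨x, hxM, hxn, hx⟩ := exists_mem_normalizer_notMem_of_lt hMlt
  obtain ⟨y, hyK, hyn, hy⟩ := exists_mem_normalizer_notMem_of_lt hKlt
  obtain htop | ⟨L, hL, hnL⟩ :=
    eq_top_or_exists_le_coatom (normalizer ((M ⊓ K : Subgroup G) : Set G))
  · have hn : (M ⊓ K).Normal := normalizer_eq_top_iff.1 htop
    by_contra hbot
    have := hquot (M ⊓ K) hbot
    exact hMn (.of_isCoatom_of_isNilpotent_quotient hM (inf_le_left : M ⊓ K ≤ M))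
  · exfalso
    obtain rfl | hML := eq_or_ne M L
    · exact hy ⟨hnL hyn, hyK⟩
    · have hle : M ⊓ K ≤ M ⊓ L := le_inf inf_le_left (le_normalizer.trans hnL)
      exact hx (hmax ⟨M, L, hM, hMn, hL, hML, rfl⟩ hle ⟨hxM, hnL hxn⟩)

theorem exists_notMem_cmt_mem {M : Subgroup G} {x y : G} {n : ℕ} (hx : x ∉ M)
    (h : engel x y n ∈ M) : ∃ z ∉ M, cmt z y ∈ M := by
  induction n with
  | zero => exact absurd h hx
  | succ k ih =>
    by_cases hk : engel x y k ∈ M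
    · exact ih hk
    · exact ⟨_, hk, h⟩

end Subgroup

open Subgroup in
/-- Zorn's theorem: a finite group satisfying an Engel law is nilpotent. -/
theorem Group.isNilpotent_of_finite_of_engel (n : ℕ) (G : Type*) [Group G] [Finite G]
    (h : ∀ x y : G, engel x y n = 1) : Group.IsNilpotent G := by
  induction hc : Nat.card G using Nat.strong_induction_on generalizing G with
  | _ c ih =>
  subst hc
  have hsub (H : Subgroup G) (hH : H ≠ ⊤) : Group.IsNilpotent H := by
    refine ih _ ?_ H (fun x y => ?_) rfl
    · exact (card_le_card_group H).lt_of_ne fun e => hH (H.eq_top_of_card_eq e)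
    · exact H.subtype_injective (by rw [map_engel, h, map_one])
  have hquot (N : Subgroup G) [N.Normal] (hN : N ≠ ⊥) : Group.IsNilpotent (G ⧸ N) := by
    refine ih _ ?_ (G ⧸ N) (fun x y => ?_) rfl
    · rw [card_eq_card_quotient_mul_card_subgroup N]
      exact lt_mul_of_one_lt_right Nat.card_pos (N.one_lt_card_iff_ne_bot.2 hN)
    · obtain ⟨x, rfl⟩ := QuotientGroup.mk'_surjective N x
      obtain ⟨y, rfl⟩ := QuotientGroup.mk'_surjective N y
      rw [← map_engel, h, map_one]
  refine (Group.isNilpotent_of_finite_tfae.out 0 2).2 fun M hM => ?_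
  by_contra hMn
  suffices M = ⊥ from hMn (this ▸ inferInstance)
  refine (eq_bot_iff_forall M).2 fun y hy => ?_
  obtain ⟨x, hx⟩ : ∃ x, x ∉ M := not_forall.1 fun hall => hM.1 ((eq_top_iff' M).2 hall)
  obtain ⟨z, hz, hzy⟩ := exists_notMem_cmt_mem hx ((h x y).symm ▸ M.one_mem : engel x y n ∈ M)
  have hconj : z⁻¹ * y * z ∈ M := by
    have : (cmt z y * y⁻¹)⁻¹ ∈ M := M.inv_mem (M.mul_mem hzy (M.inv_mem hy))
    simpa [cmt, mul_assoc] using this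
  have hK : IsCoatom (M.map (MulAut.conj z).toMonoidHom) :=
    ((MulAut.conj z).mapSubgroup.isCoatom_iff M).2 hM
  have hne : M ≠ M.map (MulAut.conj z).toMonoidHom := fun e => hMn <| by
    have hzn : z ∈ normalizer (M : Set G) := mem_normalizer_iff_map_conj_eq.2 e.symm
    exact normalizer_eq_top_iff.1 (hM.2 _ (SetLike.lt_iff_le_and_exists.2
      ⟨le_normalizer, z, hzn, hz⟩))
  have hinf := inf_eq_bot_of_isCoatom_of_not_normal hsub hquot hM hMn hK hne
  have hmem : y ∈ M ⊓ M.map (MulAut.conj z).toMonoidHom :=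
    ⟨hy, z⁻¹ * y * z, hconj, by simp [mul_assoc]⟩
  rwa [hinf, mem_bot] at hmem

/-- A non-abelian finite simple group satisfies no Engel law. -/
theorem IsSimpleGroup.exists_engel_ne_one {G : Type*} [Group G] [Finite G] [IsSimpleGroup G]
    (hG : ∃ a b : G, a * b ≠ b * a) (n : ℕ) : ∃ x y : G, engel x y n ≠ 1 := by
  by_contra! h
  have := Group.isNilpotent_of_finite_of_engel n G h
  obtain ⟨a, b, hab⟩ := hG
  exact hab (IsSimpleGroup.comm_iff_isSolvable.2 inferInstance a b)

/-- If the `n`-Engel word is nontrivial in every factor of an infinite product, then it takes at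
least continuum many values there. -/
theorem continuum_le_mk_engel {I : Type*} [Infinite I] (S : I → Type*) [∀ i, Group (S i)] (n : ℕ)
    (h : ∀ i, ∃ x y : S i, engel x y n ≠ 1) :
    Cardinal.continuum ≤ Cardinal.mk {z : ∀ i, S i | ∃ x y : ∀ i, S i, z = engel x y n} := by
  classical
  choose x y hxy using h
  let xs (T : Set ℕ) (i : I) : S i := if ∃ k ∈ T, Infinite.natEmbedding I k = i then x i else 1
  let f (T : Set ℕ) : {z : ∀ i, S i | ∃ x y : ∀ i, S i, z = engel x y n} :=
    ⟨engel (xs T) y n, xs T, y, rfl⟩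
  have hf (T : Set ℕ) (k : ℕ) :
      (f T).1 (Infinite.natEmbedding I k) ≠ 1 ↔ k ∈ T := by
    have hv : (f T).1 (Infinite.natEmbedding I k) =
        engel (xs T (Infinite.natEmbedding I k)) (y (Infinite.natEmbedding I k)) n :=
      map_engel (Pi.evalMonoidHom S _) _ _ _
    rw [hv]
    by_cases hk : k ∈ T <;> simp [xs, hk, hxy, one_engel]
  have hinj : Function.Injective f := fun T U hTU => Set.ext fun k => by
    rw [← hf T, ← hf U, hTU]
  simpa using Cardinal.mk_le_of_injective (Function.Injective.comp hinj ULift.down_injective)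

/-- If a Cartesian product of non-abelian finite simple groups has fewer than
continuum values of the `n`-Engel word, then it is finite. -/
theorem stmt15 {I : Type*} (S : I → Type*) [∀ i, Group (S i)] [∀ i, Finite (S i)]
    (hsimple : ∀ i, IsSimpleGroup (S i))
    (hnonab : ∀ i, ∃ a b : S i, a * b ≠ b * a)
    (n : ℕ) (hn : 0 < n)
    (hcard : Cardinal.mk {z : ∀ i, S i | ∃ x y : ∀ i, S i, z = engel x y n}
      < Cardinal.continuum) :
    Finite (∀ i, S i) := by
  have hI : Finite I := by
    by_contra hI
    rw [not_finite_iff_infinite] at hI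
    exact hcard.not_ge (continuum_le_mk_engel S n fun i =>
      have := hsimple i
      IsSimpleGroup.exists_engel_ne_one (hnonab i) n)
  infer_instance
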